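/- The Lie-derivative lift is a Lie algebra homomorphism on even vector fields: let V, W : Fin n → Λ be vector fields on ℝ^{0|n} with all components V α, W α odd elements of Λ (so V, W are even vector fields), and define the commutator vector field U : Fin n → Λ by U γ := Σ_β ( V β * ∂_β(W γ) − W β * ∂_β(V γ) ). Then V^↑ ∘ W^↑ − W^↑ ∘ V^↑ = U^↑ as linear endomorphisms of P. -/

import Mathlib

open TensorProduct

noncomputable section

/-- The Grassmann algebra on `n` odd generators `ξ^α`. -/
abbrev Lam (n : ℕ) : Type := ExteriorAlgebra ℝ (Fin n → ℝ)

/-- The odd coordinate `ξ^α`, i.e. the generator `e_α = ι (Pi.single α 1)`. -/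
def gen {n : ℕ} (α : Fin n) : Lam n := ExteriorAlgebra.ι ℝ (Pi.single α 1)

/-- The odd partial derivative `∂/∂ξ^α`: left contraction with the `α`-th
coordinate functional, the unique antiderivation sending `e_β` to `δ_{αβ}`. -/
def pd {n : ℕ} (α : Fin n) : Lam n →ₗ[ℝ] Lam n :=
  CliffordAlgebra.contractLeft (Q := (0 : QuadraticForm ℝ (Fin n → ℝ))) (LinearMap.proj α)

/-- The algebra of (pseudo)differential forms on `ℝ^{0|n}`:
polynomials in the even fiber coordinates `y^α` with Grassmann coefficients. -/
abbrev Forms (n : ℕ) : Type := MvPolynomial (Fin n) ℝ ⊗[ℝ] Lam n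

/-- The de Rham differential `Q = y^α ∂_{ξ^α}`. -/
def deRham (n : ℕ) : Forms n →ₗ[ℝ] Forms n :=
  ∑ α : Fin n, TensorProduct.map (LinearMap.mulLeft ℝ (MvPolynomial.X α)) (pd α)


/-- The inner product `i_V = V^α ∂_{y^α}` of the vector field `V = V^α ∂_{ξ^α}`. -/
def innerProd {n : ℕ} (V : Fin n → Lam n) : Forms n →ₗ[ℝ] Forms n :=
  ∑ α : Fin n, TensorProduct.map (MvPolynomial.pderiv α).toLinearMap
    (LinearMap.mulLeft ℝ (V α))

/-- The Lie derivative `L_V = V^α ∂_{ξ^α} + Q(V^α) ∂_{y^α}` of an even vector field. -/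
def lieDerEven {n : ℕ} (V : Fin n → Lam n) : Forms n →ₗ[ℝ] Forms n :=
  (∑ α : Fin n, TensorProduct.map LinearMap.id (LinearMap.mulLeft ℝ (V α) ∘ₗ pd α)) +
  ∑ α : Fin n, ∑ β : Fin n, TensorProduct.map
    (LinearMap.mulLeft ℝ (MvPolynomial.X β) ∘ₗ (MvPolynomial.pderiv α).toLinearMap)
    (LinearMap.mulLeft ℝ (pd β (V α)))

open CliffordAlgebra in
theorem contractLeft_mul {R M : Type*} [CommRing R] [AddCommGroup M] [Module R M]
    {Q : QuadraticForm R M} (d : Module.Dual R M) (x y : CliffordAlgebra Q) :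
    contractLeft d (x * y) = contractLeft d x * y + involute x * contractLeft d y := by
  induction x using CliffordAlgebra.left_induction with
  | algebraMap r =>
    rw [contractLeft_algebraMap_mul, contractLeft_algebraMap, zero_mul, zero_add,
      AlgHom.commutes]
  | add a b ha hb => rw [add_mul, map_add, ha, hb, map_add, map_add, add_mul, add_mul]; abel
  | ι_mul a m ha =>
    rw [mul_assoc, contractLeft_ι_mul, ha, contractLeft_ι_mul, map_mul, involute_ι]
    simp only [sub_mul, mul_add, smul_mul_assoc, neg_mul, mul_assoc]
    abel

open CliffordAlgebra in
theorem contractLeft_mem_even {R M : Type*} [CommRing R] [AddCommGroup M] [Module R M]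
    {Q : QuadraticForm R M} (d : Module.Dual R M) {x : CliffordAlgebra Q}
    (hx : x ∈ evenOdd Q 1) : contractLeft d x ∈ evenOdd Q 0 := by
  induction x, hx using CliffordAlgebra.odd_induction with
  | ι m =>
    rw [contractLeft_ι]
    exact SetLike.algebraMap_mem_graded _ _
  | add x y hx hy ihx ihy => rw [map_add]; exact add_mem ihx ihy
  | ι_mul_ι_mul m₁ m₂ x hx ih =>
    have h (m : M) : ι Q m * x ∈ evenOdd Q 0 := by
      simpa using! SetLike.mul_mem_graded (ι_mem_evenOdd_one Q m) hx
    rw [mul_assoc, contractLeft_ι_mul, contractLeft_ι_mul, mul_sub, mul_smul_comm, ← mul_assoc]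
    refine sub_mem (Submodule.smul_mem _ _ (h _)) (sub_mem (Submodule.smul_mem _ _ (h _)) ?_)
    simpa using! SetLike.mul_mem_graded (ι_mul_ι_mem_evenOdd_zero Q m₁ m₂) ih

namespace ExteriorAlgebra

variable {R M : Type*} [CommRing R] [AddCommGroup M] [Module R M]

theorem ι_mul_eq_involute_mul_ι (m : M) (x : ExteriorAlgebra R M) :
    ι R m * x = CliffordAlgebra.involute x * ι R m := by
  induction x using CliffordAlgebra.left_induction with
  | algebraMap r => rw [AlgHom.commutes]; exact (Algebra.commutes r _).symm
  | add a b ha hb => rw [mul_add, ha, hb, map_add, add_mul]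
  | ι_mul a k ha =>
    have h : ι R m * ι R k = -(ι R k * ι R m) := eq_neg_of_add_eq_zero_left (ι_add_mul_swap m k)
    rw [map_mul, CliffordAlgebra.involute_ι]
    change ι R m * (ι R k * a) = -ι R k * _ * _
    rw [← mul_assoc, h, neg_mul, mul_assoc, ha, neg_mul, neg_mul, mul_assoc]

theorem even_mul_comm {x : ExteriorAlgebra R M}
    (hx : x ∈ CliffordAlgebra.evenOdd (0 : QuadraticForm R M) 0) (y : ExteriorAlgebra R M) :
    x * y = y * x := by
  induction y using CliffordAlgebra.left_induction with
  | algebraMap r => exact (Algebra.commutes r x).symm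
  | add a b ha hb => rw [mul_add, add_mul, ha, hb]
  | ι_mul a m ha =>
    have h : ι R m * x = x * ι R m := by
      rw [ι_mul_eq_involute_mul_ι, CliffordAlgebra.involute_eq_of_mem_even hx]
    change x * (ι R m * a) = ι R m * a * x
    rw [mul_assoc, ← ha, ← mul_assoc, ← mul_assoc, h]

theorem odd_mul_odd {x y : ExteriorAlgebra R M}
    (hx : x ∈ CliffordAlgebra.evenOdd (0 : QuadraticForm R M) 1)
    (hy : y ∈ CliffordAlgebra.evenOdd (0 : QuadraticForm R M) 1) :
    x * y = -(y * x) := by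
  have h (m : M) : x * ι R m = -(ι R m * x) := by
    rw [ι_mul_eq_involute_mul_ι, CliffordAlgebra.involute_eq_of_mem_odd hx, neg_mul, neg_neg]
  induction y, hy using CliffordAlgebra.odd_induction with
  | ι m => exact h m
  | add a b _ _ ha hb => rw [mul_add, add_mul, ha, hb, neg_add]
  | ι_mul_ι_mul m₁ m₂ a _ ha =>
    change x * (ι R m₁ * ι R m₂ * a) = -(ι R m₁ * ι R m₂ * a * x)
    have he : ι R m₁ * ι R m₂ * x = x * (ι R m₁ * ι R m₂) :=
      even_mul_comm (CliffordAlgebra.ι_mul_ι_mem_evenOdd_zero _ m₁ m₂) x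
    rw [mul_assoc _ a x, ← mul_neg, ← ha, ← mul_assoc x, ← he, mul_assoc]

end ExteriorAlgebra

theorem sum_sum_sum_sum_comm {ι M : Type*} [Fintype ι] [AddCommMonoid M] (f : ι → ι → ι → ι → M) :
    ∑ a, ∑ b, ∑ c, ∑ d, f a b c d = ∑ c, ∑ d, ∑ a, ∑ b, f a b c d := by
  simpa only [Fintype.sum_prod_type] using
    Finset.sum_comm (s := (Finset.univ : Finset (ι × ι))) (t := (Finset.univ : Finset (ι × ι)))
      (f := fun p q => f p.1 p.2 q.1 q.2)

section VectorField

variable {n : ℕ}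

theorem pd_odd_mul (α : Fin n) {x : Lam n}
    (hx : x ∈ CliffordAlgebra.evenOdd (0 : QuadraticForm ℝ (Fin n → ℝ)) 1) (y : Lam n) :
    pd α (x * y) = pd α x * y - x * pd α y := by
  rw [pd, contractLeft_mul, CliffordAlgebra.involute_eq_of_mem_odd hx, neg_mul, sub_eq_add_neg]

theorem pd_even_mul (α : Fin n) {x : Lam n}
    (hx : x ∈ CliffordAlgebra.evenOdd (0 : QuadraticForm ℝ (Fin n → ℝ)) 0) (y : Lam n) :
    pd α (x * y) = pd α x * y + x * pd α y := by
  rw [pd, contractLeft_mul, CliffordAlgebra.involute_eq_of_mem_even hx]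

theorem pd_mem_even (α : Fin n) {x : Lam n}
    (hx : x ∈ CliffordAlgebra.evenOdd (0 : QuadraticForm ℝ (Fin n → ℝ)) 1) :
    pd α x ∈ CliffordAlgebra.evenOdd (0 : QuadraticForm ℝ (Fin n → ℝ)) 0 :=
  contractLeft_mem_even _ hx

theorem pd_pd_comm (α β : Fin n) (x : Lam n) : pd α (pd β x) = -pd β (pd α x) :=
  CliffordAlgebra.contractLeft_comm _ _ _

/-- The operator `V^α ∂_{ξ^α}` on the Grassmann algebra. -/
def vectorFieldAction (V : Fin n → Lam n) : Lam n →ₗ[ℝ] Lam n :=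
  ∑ α, LinearMap.mulLeft ℝ (V α) ∘ₗ pd α

theorem vectorFieldAction_apply (V : Fin n → Lam n) (x : Lam n) :
    vectorFieldAction V x = ∑ α, V α * pd α x := by
  simp [vectorFieldAction]

theorem vectorFieldAction_even_mul (V : Fin n → Lam n) {x : Lam n}
    (hx : x ∈ CliffordAlgebra.evenOdd (0 : QuadraticForm ℝ (Fin n → ℝ)) 0) (y : Lam n) :
    vectorFieldAction V (x * y) = vectorFieldAction V x * y + x * vectorFieldAction V y := by
  simp only [vectorFieldAction_apply, Finset.sum_mul, Finset.mul_sum, ← Finset.sum_add_distrib]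
  refine Finset.sum_congr rfl fun α _ => ?_
  rw [pd_even_mul α hx, mul_add, ← mul_assoc, ← mul_assoc, ← mul_assoc,
    ExteriorAlgebra.even_mul_comm hx (V α)]

theorem pd_vectorFieldAction (V : Fin n → Lam n)
    (hV : ∀ α, V α ∈ CliffordAlgebra.evenOdd (0 : QuadraticForm ℝ (Fin n → ℝ)) 1)
    (β : Fin n) (x : Lam n) :
    pd β (vectorFieldAction V x) = vectorFieldAction V (pd β x) + ∑ γ, pd β (V γ) * pd γ x := by
  simp only [vectorFieldAction_apply, map_sum, ← Finset.sum_add_distrib]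
  refine Finset.sum_congr rfl fun α _ => ?_
  rw [pd_odd_mul β (hV α), pd_pd_comm β α, mul_neg, sub_neg_eq_add, add_comm]

theorem vectorFieldAction_comp (V W : Fin n → Lam n)
    (hW : ∀ α, W α ∈ CliffordAlgebra.evenOdd (0 : QuadraticForm ℝ (Fin n → ℝ)) 1)
    (x : Lam n) :
    vectorFieldAction V (vectorFieldAction W x) =
      vectorFieldAction (fun γ => vectorFieldAction V (W γ)) x -
        ∑ α, ∑ β, V α * W β * pd α (pd β x) := by
  simp only [vectorFieldAction_apply, map_sum, Finset.sum_mul]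
  rw [Finset.sum_comm, Finset.sum_comm (f := fun γ α => V α * pd α (W γ) * pd γ x),
    ← Finset.sum_sub_distrib]
  refine Finset.sum_congr rfl fun α _ => ?_
  rw [← Finset.sum_sub_distrib]
  refine Finset.sum_congr rfl fun β _ => ?_
  rw [pd_odd_mul α (hW β), mul_sub, mul_assoc, mul_assoc]

theorem vectorFieldAction_commutator (V W : Fin n → Lam n)
    (hV : ∀ α, V α ∈ CliffordAlgebra.evenOdd (0 : QuadraticForm ℝ (Fin n → ℝ)) 1)
    (hW : ∀ α, W α ∈ CliffordAlgebra.evenOdd (0 : QuadraticForm ℝ (Fin n → ℝ)) 1)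
    (x : Lam n) :
    vectorFieldAction V (vectorFieldAction W x) - vectorFieldAction W (vectorFieldAction V x) =
      vectorFieldAction (fun γ => vectorFieldAction V (W γ)) x -
        vectorFieldAction (fun γ => vectorFieldAction W (V γ)) x := by
  have h : ∑ α, ∑ β, V α * W β * pd α (pd β x) = ∑ α, ∑ β, W α * V β * pd α (pd β x) := by
    rw [Finset.sum_comm]
    refine Finset.sum_congr rfl fun α _ => Finset.sum_congr rfl fun β _ => ?_
    rw [ExteriorAlgebra.odd_mul_odd (hV β) (hW α), pd_pd_comm β α, neg_mul_neg]
  rw [vectorFieldAction_comp V W hW, vectorFieldAction_comp W V hV, h, sub_sub_sub_cancel_right]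

theorem lieDerEven_tmul (V : Fin n → Lam n) (p : MvPolynomial (Fin n) ℝ) (x : Lam n) :
    lieDerEven V (p ⊗ₜ x) = p ⊗ₜ[ℝ] vectorFieldAction V x +
      ∑ α, ∑ β, (MvPolynomial.X β * MvPolynomial.pderiv α p) ⊗ₜ[ℝ] (pd β (V α) * x) := by
  simp [lieDerEven, vectorFieldAction_apply, TensorProduct.tmul_sum]

/-- The part of `V^↑ ∘ W^↑` that is symmetric in the even vector fields `V` and `W`. -/
def lieDerSymm (V W : Fin n → Lam n) (p : MvPolynomial (Fin n) ℝ) (x : Lam n) : Forms n :=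
  (∑ α, ∑ β, (MvPolynomial.X β * MvPolynomial.pderiv α p) ⊗ₜ[ℝ]
      (pd β (V α) * vectorFieldAction W x + pd β (W α) * vectorFieldAction V x)) +
    ∑ α, ∑ β, ∑ γ, ∑ δ, (MvPolynomial.X β * (MvPolynomial.X δ *
      MvPolynomial.pderiv α (MvPolynomial.pderiv γ p))) ⊗ₜ[ℝ] (pd β (V α) * (pd δ (W γ) * x))

theorem MvPolynomial.pderiv_comm {σ R : Type*} [CommRing R] (i j : σ) (p : MvPolynomial σ R) :
    MvPolynomial.pderiv i (MvPolynomial.pderiv j p) =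
      MvPolynomial.pderiv j (MvPolynomial.pderiv i p) := by
  classical
  have h : ⁅MvPolynomial.pderiv (R := R) i, MvPolynomial.pderiv (R := R) j⁆ = 0 := by
    refine MvPolynomial.derivation_ext fun k => ?_
    simp [Derivation.commutator_apply, MvPolynomial.pderiv_X, Pi.single_apply, apply_ite]
  simpa [Derivation.commutator_apply, sub_eq_zero] using DFunLike.congr_fun h p

theorem lieDerSymm_comm (V W : Fin n → Lam n)
    (hV : ∀ α, V α ∈ CliffordAlgebra.evenOdd (0 : QuadraticForm ℝ (Fin n → ℝ)) 1)
    (p : MvPolynomial (Fin n) ℝ) (x : Lam n) : lieDerSymm V W p x = lieDerSymm W V p x := by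
  unfold lieDerSymm
  congr 1
  · simp only [add_comm]
  · rw [sum_sum_sum_sum_comm]
    refine Finset.sum_congr rfl fun γ _ => Finset.sum_congr rfl fun δ _ =>
      Finset.sum_congr rfl fun α _ => Finset.sum_congr rfl fun β _ => ?_
    rw [MvPolynomial.pderiv_comm α γ, mul_left_comm, ← mul_assoc (pd β (V α)),
      ExteriorAlgebra.even_mul_comm (pd_mem_even β (hV α)), mul_assoc]

theorem lieDerEven_lieDerEven_tmul (V W : Fin n → Lam n)
    (hV : ∀ α, V α ∈ CliffordAlgebra.evenOdd (0 : QuadraticForm ℝ (Fin n → ℝ)) 1)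
    (hW : ∀ α, W α ∈ CliffordAlgebra.evenOdd (0 : QuadraticForm ℝ (Fin n → ℝ)) 1)
    (p : MvPolynomial (Fin n) ℝ) (x : Lam n) :
    lieDerEven V (lieDerEven W (p ⊗ₜ x)) =
      p ⊗ₜ[ℝ] vectorFieldAction V (vectorFieldAction W x) +
      ∑ α, ∑ β, (MvPolynomial.X β * MvPolynomial.pderiv α p) ⊗ₜ[ℝ]
        (pd β (vectorFieldAction V (W α)) * x) + lieDerSymm V W p x := by
  classical
  have hE (γ δ : Fin n) := vectorFieldAction_even_mul V (pd_mem_even δ (hW γ)) x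
  have hsum : ∑ γ, ∑ δ, ∑ α, ∑ β, (MvPolynomial.X β * MvPolynomial.pderiv α
        (MvPolynomial.X δ * MvPolynomial.pderiv γ p)) ⊗ₜ[ℝ] (pd β (V α) * (pd δ (W γ) * x)) =
      (∑ γ, ∑ β, (MvPolynomial.X β * MvPolynomial.pderiv γ p) ⊗ₜ[ℝ]
        ((∑ α, pd β (V α) * pd α (W γ)) * x)) +
      ∑ α, ∑ β, ∑ γ, ∑ δ, (MvPolynomial.X β * (MvPolynomial.X δ *
        MvPolynomial.pderiv α (MvPolynomial.pderiv γ p))) ⊗ₜ[ℝ]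
          (pd β (V α) * (pd δ (W γ) * x)) := by
    have h (α β γ δ : Fin n) : (MvPolynomial.X β * MvPolynomial.pderiv α
        (MvPolynomial.X δ * MvPolynomial.pderiv γ p)) ⊗ₜ[ℝ] (pd β (V α) * (pd δ (W γ) * x)) =
        (if δ = α then (MvPolynomial.X β * MvPolynomial.pderiv γ p) ⊗ₜ[ℝ]
          (pd β (V α) * (pd δ (W γ) * x)) else 0) +
        (MvPolynomial.X β * (MvPolynomial.X δ *
        MvPolynomial.pderiv α (MvPolynomial.pderiv γ p))) ⊗ₜ[ℝ]
          (pd β (V α) * (pd δ (W γ) * x)) := by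
      rw [Derivation.leibniz, MvPolynomial.pderiv_X, Pi.single_apply, smul_eq_mul, smul_eq_mul,
        mul_add, TensorProduct.add_tmul, add_comm]
      split_ifs <;> simp
    simp only [h, Finset.sum_add_distrib]
    rw [sum_sum_sum_sum_comm (fun α β γ δ => (MvPolynomial.X β * (MvPolynomial.X δ *
      MvPolynomial.pderiv α (MvPolynomial.pderiv γ p))) ⊗ₜ[ℝ] (pd β (V α) * (pd δ (W γ) * x))),
      add_left_inj]
    refine Finset.sum_congr rfl fun γ _ => ?_
    simp only [Finset.sum_mul, TensorProduct.tmul_sum]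
    rw [Finset.sum_comm]
    conv_rhs => rw [Finset.sum_comm]
    refine Finset.sum_congr rfl fun α _ => ?_
    rw [Finset.sum_comm]
    refine Finset.sum_congr rfl fun β _ => ?_
    rw [Finset.sum_ite_eq' Finset.univ α, if_pos (Finset.mem_univ α), mul_assoc]
  simp only [lieDerEven_tmul, map_add, map_sum, hE, Finset.sum_add_distrib, hsum, lieDerSymm,
    pd_vectorFieldAction V hV, add_mul, TensorProduct.tmul_add]
  abel

end VectorField

/-- The Lie-derivative lift is a Lie algebra homomorphism on even vector fields:
for even vector fields `V, W` (all components odd in `Λ`) and the commutator field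
`U γ = Σ_β (V β * ∂_β(W γ) - W β * ∂_β(V γ))`, one has `V^↑ ∘ W^↑ - W^↑ ∘ V^↑ = U^↑`. -/
theorem lieDer_commutator (n : ℕ) (hn : 1 ≤ n) (V W : Fin n → Lam n)
    (hV : ∀ α, V α ∈ CliffordAlgebra.evenOdd (0 : QuadraticForm ℝ (Fin n → ℝ)) 1)
    (hW : ∀ α, W α ∈ CliffordAlgebra.evenOdd (0 : QuadraticForm ℝ (Fin n → ℝ)) 1) :
    lieDerEven V ∘ₗ lieDerEven W - lieDerEven W ∘ₗ lieDerEven V =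
      lieDerEven (fun γ => ∑ β : Fin n, (V β * pd β (W γ) - W β * pd β (V γ))) := by
  have hU : (fun γ => ∑ β : Fin n, (V β * pd β (W γ) - W β * pd β (V γ))) =
      fun γ => vectorFieldAction V (W γ) - vectorFieldAction W (V γ) := by
    funext γ
    simp only [vectorFieldAction_apply, Finset.sum_sub_distrib]
  rw [hU]
  refine TensorProduct.ext' fun p x => ?_
  rw [LinearMap.sub_apply, LinearMap.comp_apply, LinearMap.comp_apply,
    lieDerEven_lieDerEven_tmul V W hV hW, lieDerEven_lieDerEven_tmul W V hW hV,
    lieDerSymm_comm W V hW, lieDerEven_tmul, add_sub_add_right_eq_sub, add_sub_add_comm,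
    ← TensorProduct.tmul_sub, vectorFieldAction_commutator V W hV hW]
  congr 2
  · simp only [vectorFieldAction_apply, sub_mul, Finset.sum_sub_distrib]
  · simp only [map_sub, sub_mul, TensorProduct.tmul_sub, Finset.sum_sub_distrib]
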